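/- arXiv:1808.09724 — 2 statements merged into one kernel-verified Lean document; each statement's English description precedes it below -/
import Mathlib

section
/- Let C be the middle-third Cantor set, S_x = {(b₁, b₂) ∈ C × C : −b₁ + b₂ = x}, and let U₁ = {x ∈ [−1,1] : Card(S_x) = 1}. Then dim_H U₁ = log 2 / log 3 and 0 < H^{log 2/log 3}(U₁) < ∞. -/
open MeasureTheory

namespace CantorDiff

open Filter Topology Set

/-- The representations of `x` as a difference of two elements of `C`. -/
def diffFiber (C : Set ℝ) (x : ℝ) : Set (ℝ × ℝ) :=
  {p : ℝ × ℝ | p.1 ∈ C ∧ p.2 ∈ C ∧ -p.1 + p.2 = x}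

section CantorSet

variable {C : Set ℝ}

lemma div_three_mem
    (hself : C = (fun x : ℝ => x / 3) '' C ∪ (fun x : ℝ => (x + 2) / 3) '' C)
    {c : ℝ} (h : c ∈ C) : c / 3 ∈ C := by
  rw [hself]; exact Or.inl ⟨c, h, rfl⟩

lemma add_two_div_three_mem
    (hself : C = (fun x : ℝ => x / 3) '' C ∪ (fun x : ℝ => (x + 2) / 3) '' C)
    {c : ℝ} (h : c ∈ C) : (c + 2) / 3 ∈ C := by
  rw [hself]; exact Or.inr ⟨c, h, rfl⟩

lemma exists_preimage
    (hself : C = (fun x : ℝ => x / 3) '' C ∪ (fun x : ℝ => (x + 2) / 3) '' C)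
    {c : ℝ} (h : c ∈ C) : ∃ d ∈ C, c = d / 3 ∨ c = (d + 2) / 3 := by
  rw [hself] at h
  rcases h with ⟨d, hd, rfl⟩ | ⟨d, hd, rfl⟩
  exacts [⟨d, hd, Or.inl rfl⟩, ⟨d, hd, Or.inr rfl⟩]

lemma subset_Icc (hc : IsCompact C)
    (hself : C = (fun x : ℝ => x / 3) '' C ∪ (fun x : ℝ => (x + 2) / 3) '' C) :
    C ⊆ Icc 0 1 := by
  intro c h
  have hne : C.Nonempty := ⟨c, h⟩
  constructor
  · obtain ⟨m, hm, hle⟩ := hc.exists_isLeast hne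
    have := hle h
    obtain ⟨d, hd, e⟩ := exists_preimage hself hm
    have := hle hd
    rcases e with e | e <;> linarith
  · obtain ⟨m, hm, hle⟩ := hc.exists_isGreatest hne
    have := hle h
    obtain ⟨d, hd, e⟩ := exists_preimage hself hm
    have := hle hd
    rcases e with e | e <;> linarith

lemma exists_diff_near (hne : C.Nonempty)
    (hself : C = (fun x : ℝ => x / 3) '' C ∪ (fun x : ℝ => (x + 2) / 3) '' C) (n : ℕ) :
    ∀ x ∈ Icc (-1 : ℝ) 1, ∃ b₁ ∈ C, ∃ b₂ ∈ C, |-b₁ + b₂ - x| ≤ (1 / 3) ^ n := by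
  induction n with
  | zero =>
    rintro x ⟨h1, h2⟩
    obtain ⟨c, h⟩ := hne
    exact ⟨c, h, c, h, by simpa [abs_le] using ⟨h1, h2⟩⟩
  | succ n ih =>
    rintro x ⟨h1, h2⟩
    have key : ∃ e : ℝ, 3 * x - e ∈ Icc (-1 : ℝ) 1 ∧ ∀ b₁ ∈ C, ∀ b₂ ∈ C,
        ∃ c₁ ∈ C, ∃ c₂ ∈ C, -c₁ + c₂ = (-b₁ + b₂ + e) / 3 := by
      rcases le_or_gt x (-1 / 3) with h | h
      · exact ⟨-2, ⟨by linarith, by linarith⟩, fun b₁ hb₁ b₂ hb₂ =>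
          ⟨_, add_two_div_three_mem hself hb₁, _, div_three_mem hself hb₂, by ring⟩⟩
      rcases le_or_gt x (1 / 3) with h' | h'
      · exact ⟨0, ⟨by linarith, by linarith⟩, fun b₁ hb₁ b₂ hb₂ =>
          ⟨_, div_three_mem hself hb₁, _, div_three_mem hself hb₂, by ring⟩⟩
      · exact ⟨2, ⟨by linarith, by linarith⟩, fun b₁ hb₁ b₂ hb₂ =>
          ⟨_, div_three_mem hself hb₁, _, add_two_div_three_mem hself hb₂, by ring⟩⟩
    obtain ⟨e, he, hlift⟩ := key
    obtain ⟨b₁, hb₁, b₂, hb₂, hb⟩ := ih _ he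
    obtain ⟨c₁, hc₁, c₂, hc₂, hcb⟩ := hlift b₁ hb₁ b₂ hb₂
    refine ⟨c₁, hc₁, c₂, hc₂, ?_⟩
    rw [abs_le] at hb ⊢
    rw [hcb, pow_succ]
    constructor <;> linarith [hb.1, hb.2]

lemma diffFiber_nonempty (hne : C.Nonempty) (hc : IsCompact C)
    (hself : C = (fun x : ℝ => x / 3) '' C ∪ (fun x : ℝ => (x + 2) / 3) '' C)
    {x : ℝ} (hx : x ∈ Icc (-1 : ℝ) 1) : (diffFiber C x).Nonempty := by
  have hcl : IsClosed ((fun p : ℝ × ℝ => -p.1 + p.2) '' (C ×ˢ C)) :=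
    ((hc.prod hc).image (by fun_prop)).isClosed
  have hmem : x ∈ (fun p : ℝ × ℝ => -p.1 + p.2) '' (C ×ˢ C) := by
    rw [← hcl.closure_eq, Metric.mem_closure_iff]
    intro ε hε
    obtain ⟨n, hn⟩ := exists_pow_lt_of_lt_one hε (by norm_num : (1 / 3 : ℝ) < 1)
    obtain ⟨b₁, hb₁, b₂, hb₂, hb⟩ := exists_diff_near hne hself n x hx
    refine ⟨_, ⟨(b₁, b₂), ⟨hb₁, hb₂⟩, rfl⟩, ?_⟩
    rw [dist_comm, Real.dist_eq]
    exact hb.trans_lt hn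
  obtain ⟨p, hp, rfl⟩ := hmem
  exact ⟨p, hp.1, hp.2, rfl⟩

/-- The numbers in `[-1, 1]` with exactly one representation as a difference of elements of `C`. -/
def uniqueDiff (C : Set ℝ) : Set ℝ := {x ∈ Icc (-1 : ℝ) 1 | (diffFiber C x).encard = 1}

lemma mem_uniqueDiff (hne : C.Nonempty) (hc : IsCompact C)
    (hself : C = (fun x : ℝ => x / 3) '' C ∪ (fun x : ℝ => (x + 2) / 3) '' C) {x : ℝ} :
    x ∈ uniqueDiff C ↔ x ∈ Icc (-1 : ℝ) 1 ∧ (diffFiber C x).Subsingleton := by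
  refine and_congr_right fun hx => ?_
  rw [encard_eq_one, exists_eq_singleton_iff_nonempty_subsingleton]
  exact and_iff_right (diffFiber_nonempty hne hc hself hx)

lemma exists_uniqueDiff_preimage (hne : C.Nonempty) (hc : IsCompact C)
    (hself : C = (fun x : ℝ => x / 3) '' C ∪ (fun x : ℝ => (x + 2) / 3) '' C)
    {x : ℝ} (hx : x ∈ uniqueDiff C) :
    ∃ y ∈ uniqueDiff C, x = (y - 2) / 3 ∨ x = (y + 2) / 3 := by
  rw [mem_uniqueDiff hne hc hself] at hx
  obtain ⟨⟨h1, h2⟩, hs⟩ := hx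
  rcases le_or_gt x (-1 / 3) with h | h
  · refine ⟨3 * x + 2, (mem_uniqueDiff hne hc hself).2
      ⟨⟨by linarith, by linarith⟩, ?_⟩, Or.inl (by ring)⟩
    rintro ⟨p₁, p₂⟩ ⟨hp₁, hp₂, hp⟩ ⟨q₁, q₂⟩ ⟨hq₁, hq₂, hq⟩
    dsimp only at *
    have := @hs ((p₁ + 2) / 3, p₂ / 3)
      ⟨add_two_div_three_mem hself hp₁, div_three_mem hself hp₂, by dsimp only; linarith⟩
      ((q₁ + 2) / 3, q₂ / 3)
      ⟨add_two_div_three_mem hself hq₁, div_three_mem hself hq₂, by dsimp only; linarith⟩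
    rw [Prod.mk.injEq] at this ⊢
    constructor <;> linarith [this.1, this.2]
  rcases le_or_gt x (1 / 3) with h' | h'
  · obtain ⟨p, hp₁, hp₂, hp⟩ := diffFiber_nonempty hne hc hself
      (x := 3 * x) ⟨by linarith, by linarith⟩
    have := @hs (p.1 / 3, p.2 / 3)
      ⟨div_three_mem hself hp₁, div_three_mem hself hp₂, by dsimp only; linarith⟩
      ((p.1 + 2) / 3, (p.2 + 2) / 3)
      ⟨add_two_div_three_mem hself hp₁, add_two_div_three_mem hself hp₂, by dsimp only; linarith⟩
    rw [Prod.mk.injEq] at this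
    linarith [this.1]
  · refine ⟨3 * x - 2, (mem_uniqueDiff hne hc hself).2
      ⟨⟨by linarith, by linarith⟩, ?_⟩, Or.inr (by ring)⟩
    rintro ⟨p₁, p₂⟩ ⟨hp₁, hp₂, hp⟩ ⟨q₁, q₂⟩ ⟨hq₁, hq₂, hq⟩
    dsimp only at *
    have := @hs (p₁ / 3, (p₂ + 2) / 3)
      ⟨div_three_mem hself hp₁, add_two_div_three_mem hself hp₂, by dsimp only; linarith⟩
      (q₁ / 3, (q₂ + 2) / 3)
      ⟨div_three_mem hself hq₁, add_two_div_three_mem hself hq₂, by dsimp only; linarith⟩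
    rw [Prod.mk.injEq] at this ⊢
    constructor <;> linarith [this.1, this.2]

end CantorSet

lemma three_rpow_log_ratio : (3 : ℝ) ^ (Real.log 2 / Real.log 3) = 2 := by
  have h3 : Real.log 3 ≠ 0 := (Real.log_pos (by norm_num)).ne'
  rw [Real.rpow_def_of_pos (by norm_num), mul_div_cancel₀ _ h3, Real.exp_log (by norm_num)]

lemma third_pow_rpow_log_ratio (n : ℕ) :
    (((1 / 3 : ℝ)) ^ n) ^ (Real.log 2 / Real.log 3) = (1 / 2) ^ n := by
  rw [← Real.rpow_natCast, ← Real.rpow_mul (by norm_num), mul_comm, Real.rpow_mul (by norm_num),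
    one_div, Real.inv_rpow (by norm_num), three_rpow_log_ratio, Real.rpow_natCast, one_div]

lemma log_ratio_pos : 0 < Real.log 2 / Real.log 3 :=
  div_pos (Real.log_pos (by norm_num)) (Real.log_pos (by norm_num))

section UpperBound

/-- The image of `0` under the `n`-fold compositions of `x ↦ (x ± 2) / 3`. -/
noncomputable def centers : ℕ → Finset ℝ
  | 0 => {0}
  | n + 1 => (centers n).image (fun x => (x - 2) / 3) ∪ (centers n).image (fun x => (x + 2) / 3)

lemma card_centers_le (n : ℕ) : (centers n).card ≤ 2 ^ n := by
  induction n with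
  | zero => simp [centers]
  | succ n ih =>
    have h1 := Finset.card_image_le (s := centers n) (f := fun x => (x - 2) / 3)
    have h2 := Finset.card_image_le (s := centers n) (f := fun x => (x + 2) / 3)
    refine (Finset.card_union_le _ _).trans ?_
    rw [pow_succ]
    omega

lemma exists_center_near {U : Set ℝ} (hU : U ⊆ Icc (-1) 1)
    (hstep : ∀ x ∈ U, ∃ y ∈ U, x = (y - 2) / 3 ∨ x = (y + 2) / 3) (n : ℕ) :
    ∀ x ∈ U, ∃ c ∈ centers n, x ∈ Icc (c - (1 / 3) ^ n) (c + (1 / 3) ^ n) := by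
  induction n with
  | zero =>
    intro x hx
    exact ⟨0, by simp [centers], by simpa using hU hx⟩
  | succ n ih =>
    intro x hx
    obtain ⟨y, hy, e⟩ := hstep x hx
    obtain ⟨c, hc, h1, h2⟩ := ih y hy
    rcases e with e | e
    · refine ⟨(c - 2) / 3, Finset.mem_union_left _ (Finset.mem_image_of_mem _ hc), ?_, ?_⟩ <;>
      rw [pow_succ] <;> linarith
    · refine ⟨(c + 2) / 3, Finset.mem_union_right _ (Finset.mem_image_of_mem _ hc), ?_, ?_⟩ <;>
      rw [pow_succ] <;> linarith

lemma hausdorffMeasure_lt_top {U : Set ℝ} (hU : U ⊆ Icc (-1) 1)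
    (hstep : ∀ x ∈ U, ∃ y ∈ U, x = (y - 2) / 3 ∨ x = (y + 2) / 3) :
    μH[Real.log 2 / Real.log 3] U < ⊤ := by
  set s := Real.log 2 / Real.log 3
  have hdiam : ∀ (n : ℕ) (c : ℝ), Metric.ediam (Icc (c - (1 / 3 : ℝ) ^ n) (c + (1 / 3) ^ n)) =
      ENNReal.ofReal (2 * (1 / 3) ^ n) := by
    intro n c
    rw [Real.ediam_Icc]
    congr 1
    ring
  have hlim : Tendsto (fun n : ℕ => ENNReal.ofReal (2 * (1 / 3) ^ n)) atTop (𝓝 0) := by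
    have := (tendsto_pow_atTop_nhds_zero_of_lt_one (by norm_num : (0 : ℝ) ≤ 1 / 3)
      (by norm_num)).const_mul 2
    simpa using ENNReal.tendsto_ofReal this
  have hle := Measure.hausdorffMeasure_le_liminf_sum (ι := fun n => centers n) s U _ hlim
    (fun n c => Icc ((c : ℝ) - (1 / 3 : ℝ) ^ n) (c + (1 / 3) ^ n))
    (Eventually.of_forall fun n c => (hdiam n c).le)
    (Eventually.of_forall fun n x hx => by
      obtain ⟨c, hc, h⟩ := exists_center_near hU hstep n x hx
      exact mem_iUnion.2 ⟨⟨c, hc⟩, h⟩)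
  refine hle.trans_lt (lt_of_le_of_lt (b := ENNReal.ofReal (2 ^ s)) ?_ ENNReal.ofReal_lt_top)
  refine liminf_le_of_le (by isBoundedDefault) fun b hb => ?_
  obtain ⟨n, hn⟩ := hb.exists
  refine hn.trans ?_
  simp only [hdiam]
  rw [ENNReal.ofReal_rpow_of_nonneg (by positivity) log_ratio_pos.le,
    Real.mul_rpow (by norm_num) (by positivity), third_pow_rpow_log_ratio, Finset.sum_const,
    Finset.card_univ, Fintype.card_coe, nsmul_eq_mul, ← ENNReal.ofReal_natCast,
    ← ENNReal.ofReal_mul (by positivity)]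
  refine ENNReal.ofReal_le_ofReal ?_
  have h1 : ((centers n).card : ℝ) ≤ 2 ^ n := by exact_mod_cast card_centers_le n
  calc ((centers n).card : ℝ) * (2 ^ s * (1 / 2) ^ n)
      ≤ 2 ^ n * (2 ^ s * (1 / 2) ^ n) := by gcongr
    _ = 2 ^ s * (2 * (1 / 2)) ^ n := by rw [mul_pow]; ring
    _ = 2 ^ s := by norm_num

end UpperBound

section LowerBound

/-- The first binary digit of the fractional part of `u`, encoded as `-1` or `1`. -/
noncomputable def binarySign (u : ℝ) : ℝ := if Int.fract u < 1 / 2 then -1 else 1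

lemma binarySign_cases (u : ℝ) :
    (binarySign u = -1 ∧ Int.fract (2 * u) = 2 * Int.fract u) ∨
      (binarySign u = 1 ∧ Int.fract (2 * u) = 2 * Int.fract u - 1) := by
  have h0 := Int.fract_nonneg u
  have h1 := Int.fract_lt_one u
  have h2 := Int.floor_add_fract u
  unfold binarySign
  split_ifs with h
  · refine Or.inl ⟨rfl, Int.fract_eq_iff.2 ⟨by linarith, by linarith, 2 * ⌊u⌋, ?_⟩⟩
    push_cast
    linarith
  · refine Or.inr ⟨rfl, Int.fract_eq_iff.2 ⟨by linarith, by linarith, 2 * ⌊u⌋ + 1, ?_⟩⟩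
    push_cast
    linarith

lemma abs_binarySign (u : ℝ) : |binarySign u| = 1 := by
  rcases binarySign_cases u with h | h <;> simp [h.1]

/-- The number whose signed ternary digits are `-2` or `2` according to the binary digits of the
fractional part of `u`. -/
noncomputable def signedTernary (u : ℝ) : ℝ :=
  ∑' n : ℕ, 2 / 3 * (1 / 3) ^ n * binarySign (2 ^ n * u)

lemma hasSum_geometric_bound : HasSum (fun n : ℕ => 2 / 3 * (1 / 3 : ℝ) ^ n) 1 := by
  have := (hasSum_geometric_of_lt_one (by norm_num : (0 : ℝ) ≤ 1 / 3)
    (by norm_num)).mul_left (2 / 3)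
  norm_num at this ⊢
  exact this

lemma norm_term_le (u : ℝ) (n : ℕ) :
    ‖2 / 3 * (1 / 3 : ℝ) ^ n * binarySign (2 ^ n * u)‖ ≤ 2 / 3 * (1 / 3 : ℝ) ^ n := by
  rw [norm_mul, Real.norm_eq_abs (binarySign _), abs_binarySign, mul_one, Real.norm_eq_abs,
    abs_of_nonneg (by positivity)]

lemma abs_signedTernary_le (u : ℝ) : |signedTernary u| ≤ 1 :=
  tsum_of_norm_bounded hasSum_geometric_bound (norm_term_le u)

lemma signedTernary_eq (u : ℝ) :
    signedTernary u = (2 * binarySign u + signedTernary (2 * u)) / 3 := by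
  have hsum := Summable.of_norm_bounded hasSum_geometric_bound.summable (norm_term_le u)
  have h : ∀ n : ℕ, 2 / 3 * (1 / 3 : ℝ) ^ (n + 1) * binarySign (2 ^ (n + 1) * u) =
      1 / 3 * (2 / 3 * (1 / 3) ^ n * binarySign (2 ^ n * (2 * u))) := by
    intro n
    rw [show (2 : ℝ) ^ (n + 1) * u = 2 ^ n * (2 * u) by ring]
    ring
  rw [signedTernary, hsum.tsum_eq_zero_add]
  simp only [h]
  rw [tsum_mul_left, ← signedTernary, pow_zero, pow_zero, one_mul]
  ring

lemma fract_le_of_signedTernary_eq_neg_one (n : ℕ) :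
    ∀ u, signedTernary u = -1 → Int.fract u ≤ (1 / 2) ^ n := by
  induction n with
  | zero => intro u _; simpa using (Int.fract_lt_one u).le
  | succ n ih =>
    intro u hu
    have h1 := signedTernary_eq u
    have h2 := abs_le.1 (abs_signedTernary_le (2 * u))
    rw [pow_succ]
    rcases binarySign_cases u with ⟨h, h'⟩ | ⟨h, h'⟩ <;> rw [h] at h1
    · linarith [ih (2 * u) (by linarith)]
    · linarith

lemma one_sub_fract_le_of_signedTernary_eq_one (n : ℕ) :
    ∀ u, signedTernary u = 1 → 1 - Int.fract u ≤ (1 / 2) ^ n := by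
  induction n with
  | zero => intro u _; simp
  | succ n ih =>
    intro u hu
    have h1 := signedTernary_eq u
    have h2 := abs_le.1 (abs_signedTernary_le (2 * u))
    rw [pow_succ]
    rcases binarySign_cases u with ⟨h, h'⟩ | ⟨h, h'⟩ <;> rw [h] at h1
    · linarith
    · linarith [ih (2 * u) (by linarith)]

lemma abs_signedTernary_lt {u : ℝ} (hu : Irrational u) : |signedTernary u| < 1 := by
  have hle := abs_le.1 (abs_signedTernary_le u)
  refine abs_lt.2 ⟨hle.1.lt_of_ne fun h => ?_, hle.2.lt_of_ne fun h => ?_⟩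
  · have h0 : 0 < Int.fract u := by
      refine (Int.fract_nonneg u).lt_of_ne fun h0 => hu ⟨⌊u⌋, ?_⟩
      have := Int.floor_add_fract u
      push_cast
      linarith
    obtain ⟨n, hn⟩ := exists_pow_lt_of_lt_one h0 (by norm_num : (1 / 2 : ℝ) < 1)
    linarith [fract_le_of_signedTernary_eq_neg_one n u h.symm]
  · obtain ⟨n, hn⟩ := exists_pow_lt_of_lt_one (sub_pos.2 (Int.fract_lt_one u))
      (by norm_num : (1 / 2 : ℝ) < 1)
    linarith [one_sub_fract_le_of_signedTernary_eq_one n u h]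

lemma abs_fract_sub_le (n : ℕ) :
    ∀ u v, |signedTernary u - signedTernary v| < 2 * (1 / 3) ^ n →
      |Int.fract u - Int.fract v| ≤ (1 / 2) ^ n := by
  induction n with
  | zero =>
    intro u v _
    rw [pow_zero, abs_le]
    constructor <;> linarith [Int.fract_nonneg u, Int.fract_nonneg v, Int.fract_lt_one u,
      Int.fract_lt_one v]
  | succ n ih =>
    intro u v huv
    have hu := signedTernary_eq u
    have hv := signedTernary_eq v
    have hu' := abs_le.1 (abs_signedTernary_le (2 * u))
    have hv' := abs_le.1 (abs_signedTernary_le (2 * v))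
    have hp : (1 / 3 : ℝ) ^ n ≤ 1 := pow_le_one₀ (by norm_num) (by norm_num)
    rw [pow_succ, abs_lt] at huv
    have hrec := ih (2 * u) (2 * v)
    rw [abs_lt, abs_le] at hrec
    rw [pow_succ, abs_le]
    rcases binarySign_cases u with ⟨h, h'⟩ | ⟨h, h'⟩ <;>
    rcases binarySign_cases v with ⟨k, k'⟩ | ⟨k, k'⟩ <;> rw [h] at hu <;> rw [k] at hv
    · have := hrec ⟨by linarith, by linarith⟩
      constructor <;> linarith
    · linarith
    · linarith
    · have := hrec ⟨by linarith, by linarith⟩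
      constructor <;> linarith

lemma abs_sub_le_rpow {u v : ℝ} (hu : u ∈ Ico (0 : ℝ) 1) (hv : v ∈ Ico (0 : ℝ) 1) :
    |u - v| ≤ 2 * |signedTernary u - signedTernary v| ^ (Real.log 2 / Real.log 3) := by
  rcases eq_or_ne u v with rfl | huv
  · simp only [sub_self, abs_zero]; positivity
  obtain ⟨n, hn, hn'⟩ := exists_nat_pow_near_of_lt_one (abs_pos.2 (sub_ne_zero.2 huv))
    (abs_le.2 ⟨by linarith [hu.1, hv.2], by linarith [hu.2, hv.1]⟩)
    (by norm_num : (0 : ℝ) < 1 / 2) (by norm_num)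
  have hfar : 2 * (1 / 3) ^ (n + 1) ≤ |signedTernary u - signedTernary v| := by
    by_contra! h
    have := abs_fract_sub_le (n + 1) u v h
    rw [Int.fract_eq_self.2 hu, Int.fract_eq_self.2 hv] at this
    linarith
  have hp : (0 : ℝ) < (1 / 3) ^ (n + 1) := by positivity
  calc |u - v| ≤ (1 / 2) ^ n := hn'
    _ = 2 * (((1 / 3 : ℝ)) ^ (n + 1)) ^ (Real.log 2 / Real.log 3) := by
      rw [third_pow_rpow_log_ratio, pow_succ]; ring
    _ ≤ _ := by
      have := Real.rpow_le_rpow hp.le (by linarith : _ ≤ |signedTernary u - signedTernary v|)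
        log_ratio_pos.le
      linarith

lemma volume_irrational_Ico : volume ({u : ℝ | Irrational u} ∩ Ico 0 1) = 1 := by
  have h : ({u : ℝ | Irrational u} ∩ Ico 0 1) = Ico 0 1 \ range ((↑) : ℚ → ℝ) := by
    ext u
    exact and_comm
  rw [h, measure_sdiff_null ((countable_range _).measure_zero _)]
  simp

lemma hausdorffMeasure_pos {U : Set ℝ} (hU : ∀ u, Irrational u → signedTernary u ∈ U) :
    0 < μH[Real.log 2 / Real.log 3] U := by
  set A : Set ℝ := {u : ℝ | Irrational u} ∩ Ico 0 1
  have hinj : InjOn signedTernary A := by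
    intro u hu v hv h
    have := abs_sub_le_rpow hu.2 hv.2
    rw [h, sub_self, abs_zero, Real.zero_rpow log_ratio_pos.ne', mul_zero] at this
    exact sub_eq_zero.1 (abs_nonpos_iff.1 this)
  set g := Function.invFunOn signedTernary A
  have hg : ∀ u ∈ A, g (signedTernary u) = u := hinj.leftInvOn_invFunOn
  have himg : g '' (signedTernary '' A) = A := hinj.leftInvOn_invFunOn.image_image
  set s : NNReal := ⟨Real.log 2 / Real.log 3, log_ratio_pos.le⟩
  have hold : HolderOnWith 2 s g (signedTernary '' A) := by
    rintro _ ⟨u, hu, rfl⟩ _ ⟨v, hv, rfl⟩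
    rw [hg u hu, hg v hv, edist_dist, edist_dist, Real.dist_eq, Real.dist_eq,
      ENNReal.ofReal_rpow_of_nonneg (abs_nonneg _) s.coe_nonneg]
    have h2 : ((2 : NNReal) : ENNReal) = ENNReal.ofReal 2 := by simp
    rw [h2, ← ENNReal.ofReal_mul (by norm_num)]
    exact ENNReal.ofReal_le_ofReal (abs_sub_le_rpow hu.2 hv.2)
  have hle := hold.hausdorffMeasure_image_le (show 0 < s from log_ratio_pos) zero_le_one
  rw [himg, hausdorffMeasure_real, volume_irrational_Ico, mul_one] at hle
  have hsub : signedTernary '' A ⊆ U := by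
    rintro _ ⟨u, hu, rfl⟩
    exact hU u hu.1
  refine lt_of_lt_of_le ?_ (measure_mono hsub)
  refine pos_iff_ne_zero.2 fun h0 => ?_
  change 1 ≤ _ * μH[Real.log 2 / Real.log 3] (signedTernary '' A) at hle
  rw [h0, mul_zero] at hle
  exact absurd hle (by simp)

variable {C : Set ℝ}

lemma abs_fst_sub_le (hc : IsCompact C)
    (hself : C = (fun x : ℝ => x / 3) '' C ∪ (fun x : ℝ => (x + 2) / 3) '' C) (n : ℕ) :
    ∀ u, Irrational u → ∀ p ∈ diffFiber C (signedTernary u), ∀ q ∈ diffFiber C (signedTernary u),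
      |p.1 - q.1| ≤ (1 / 3) ^ n := by
  have hI := subset_Icc hc hself
  induction n with
  | zero =>
    rintro u - p ⟨hp, -, -⟩ q ⟨hq, -, -⟩
    rw [pow_zero, abs_le]
    constructor <;> linarith [(hI hp).1, (hI hp).2, (hI hq).1, (hI hq).2]
  | succ n ih =>
    have hlift : ∀ u, Irrational u → ∀ p ∈ diffFiber C (signedTernary u),
        ∃ p' ∈ diffFiber C (signedTernary (2 * u)), p.1 = (p'.1 + (1 - binarySign u)) / 3 := by
      rintro u hu ⟨p₁, p₂⟩ ⟨hp₁, hp₂, hp⟩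
      obtain ⟨d₁, hd₁, e₁⟩ := exists_preimage hself hp₁
      obtain ⟨d₂, hd₂, e₂⟩ := exists_preimage hself hp₂
      have h2u : Irrational (2 * u) := by exact_mod_cast hu.natCast_mul (two_ne_zero)
      have hlt := abs_lt.1 (abs_signedTernary_lt h2u)
      have heq := signedTernary_eq u
      have i₁ := hI hd₁
      have i₂ := hI hd₂
      refine ⟨(d₁, d₂), ⟨hd₁, hd₂, ?_⟩, ?_⟩ <;>
      rcases binarySign_cases u with ⟨h, -⟩ | ⟨h, -⟩ <;> rw [h] at heq <;>
      try rw [h]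
      all_goals
        rcases e₁ with e₁ | e₁ <;> rcases e₂ with e₂ | e₂ <;> dsimp only at * <;>
        linarith [i₁.1, i₁.2, i₂.1, i₂.2, hlt.1, hlt.2]
    intro u hu p hp q hq
    obtain ⟨p', hp', e⟩ := hlift u hu p hp
    obtain ⟨q', hq', k⟩ := hlift u hu q hq
    have h2u : Irrational (2 * u) := by exact_mod_cast hu.natCast_mul (two_ne_zero)
    have := abs_le.1 (ih _ h2u p' hp' q' hq')
    rw [e, k, pow_succ, abs_le]
    constructor <;> linarith [this.1, this.2]

lemma signedTernary_mem_uniqueDiff (hne : C.Nonempty) (hc : IsCompact C)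
    (hself : C = (fun x : ℝ => x / 3) '' C ∪ (fun x : ℝ => (x + 2) / 3) '' C)
    {u : ℝ} (hu : Irrational u) : signedTernary u ∈ uniqueDiff C := by
  refine (mem_uniqueDiff hne hc hself).2 ⟨abs_le.1 (abs_signedTernary_le u), ?_⟩
  intro p hp q hq
  have h1 : p.1 = q.1 := by
    by_contra h
    obtain ⟨n, hn⟩ := exists_pow_lt_of_lt_one (abs_pos.2 (sub_ne_zero.2 h))
      (by norm_num : (1 / 3 : ℝ) < 1)
    linarith [abs_fst_sub_le hc hself n u hu p hp q hq]
  exact Prod.ext h1 (by linarith [hp.2.2, hq.2.2])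

end LowerBound

end CantorDiff

/-- For the middle-third Cantor set `C` and `S_x = {(b₁,b₂) ∈ C × C : -b₁ + b₂ = x}`, the set
`U₁` of `x ∈ [-1,1]` with exactly one representation has Hausdorff dimension `log 2 / log 3`,
and its `(log 2 / log 3)`-dimensional Hausdorff measure is positive and finite. -/
theorem cantor_diff_unique_representation_dimension (C : Set ℝ) (hne : C.Nonempty)
    (hc : IsCompact C)
    (hself : C = (fun x : ℝ => x / 3) '' C ∪ (fun x : ℝ => (x + 2) / 3) '' C)
    (U₁ : Set ℝ)
    (hU : U₁ = {x ∈ Set.Icc (-1 : ℝ) 1 |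
      {p : ℝ × ℝ | p.1 ∈ C ∧ p.2 ∈ C ∧ -p.1 + p.2 = x}.encard = 1}) :
    dimH U₁ = ENNReal.ofReal (Real.log 2 / Real.log 3) ∧
    0 < μH[Real.log 2 / Real.log 3] U₁ ∧ μH[Real.log 2 / Real.log 3] U₁ < ⊤ := by
  change U₁ = CantorDiff.uniqueDiff C at hU
  subst hU
  have hpos := CantorDiff.hausdorffMeasure_pos
    fun u hu => CantorDiff.signedTernary_mem_uniqueDiff hne hc hself hu
  have hfin := CantorDiff.hausdorffMeasure_lt_top (fun x hx => hx.1)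
    fun x hx => CantorDiff.exists_uniqueDiff_preimage hne hc hself hx
  refine ⟨?_, hpos, hfin⟩
  have h := dimH_of_hausdorffMeasure_ne_zero_ne_top
    (d := ⟨Real.log 2 / Real.log 3, CantorDiff.log_ratio_pos.le⟩) hpos.ne' hfin.ne
  exact h.trans (ENNReal.ofReal_eq_coe_nnreal CantorDiff.log_ratio_pos.le).symm
end

section
/- Let C be the middle-third Cantor set and S_x = {(b₁, b₂) ∈ C × C : −b₁ + b₂ = x}. For each u ∈ ℕ⁺, the set {x ∈ [−1,1] : Card(S_x) = 2^u} has Hausdorff dimension log 2 / log 3 and its (log 2/log 3)-dimensional Hausdorff measure is infinite. -/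
open MeasureTheory

/-- A bounded set which is covered by its images under the maps `y ↦ (y + e) / 3`, `e ∈ E`, lies in
every nonempty closed set which is stable under these maps. -/
lemma subset_of_forall_exists_add_div_three {E A B : Set ℝ} (hA : Bornology.IsBounded A)
    (hAE : ∀ x ∈ A, ∃ y ∈ A, ∃ e ∈ E, x = (y + e) / 3) (hB : IsClosed B) (hne : B.Nonempty)
    (hBE : ∀ y ∈ B, ∀ e ∈ E, (y + e) / 3 ∈ B) : A ⊆ B := by
  obtain ⟨b₀, hb₀⟩ := hne
  obtain ⟨K, hK⟩ := hA.subset_closedBall b₀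
  have approx : ∀ n : ℕ, ∀ a ∈ A, ∃ b ∈ B, dist a b ≤ K / 3 ^ n := by
    intro n
    induction n with
    | zero => exact fun a ha => ⟨b₀, hb₀, by simpa using hK ha⟩
    | succ n ih =>
      intro a ha
      obtain ⟨y, hy, e, he, rfl⟩ := hAE a ha
      obtain ⟨b, hb, hyb⟩ := ih y hy
      refine ⟨(b + e) / 3, hBE b hb e he, ?_⟩
      rw [Real.dist_eq] at hyb ⊢
      rw [show (y + e) / 3 - (b + e) / 3 = (y - b) / 3 by ring, abs_div, pow_succ, ← div_div]
      simpa using div_le_div_of_nonneg_right hyb (by norm_num : (0 : ℝ) ≤ 3)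
  intro a ha
  rw [← hB.closure_eq, Metric.mem_closure_iff]
  intro ε hε
  have hlim : Filter.Tendsto (fun n : ℕ => K / (3 : ℝ) ^ n) Filter.atTop (nhds 0) :=
    tendsto_const_nhds.div_atTop (tendsto_pow_atTop_atTop_of_one_lt (by norm_num))
  obtain ⟨n, hn⟩ := (hlim.eventually_lt_const hε).exists
  obtain ⟨b, hb, hab⟩ := approx n a ha
  exact ⟨b, hb, hab.trans_lt hn⟩

lemma mem_cantorSet_iff_exists {x : ℝ} :
    x ∈ cantorSet ↔ ∃ y ∈ cantorSet, ∃ e ∈ ({0, 2} : Set ℝ), x = (y + e) / 3 := by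
  conv_lhs => rw [cantorSet_eq_union_halves]
  simp only [Set.mem_union, Set.mem_image, Set.mem_insert_iff, Set.mem_singleton_iff,
    exists_eq_or_imp, exists_eq_left, add_zero]
  constructor
  · rintro (⟨y, hy, rfl⟩ | ⟨y, hy, rfl⟩)
    · exact ⟨y, hy, Or.inl rfl⟩
    · exact ⟨y, hy, Or.inr (by ring)⟩
  · rintro ⟨y, hy, rfl | rfl⟩
    · exact Or.inl ⟨y, hy, rfl⟩
    · exact Or.inr ⟨y, hy, by ring⟩

lemma add_div_three_mem_cantorSet {y : ℝ} (hy : y ∈ cantorSet) {e : ℝ}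
    (he : e ∈ ({0, 2} : Set ℝ)) : (y + e) / 3 ∈ cantorSet :=
  mem_cantorSet_iff_exists.2 ⟨y, hy, e, he, rfl⟩

lemma eq_cantorSet_of_isCompact {C : Set ℝ} (hne : C.Nonempty) (hc : IsCompact C)
    (hself : C = (fun x : ℝ => x / 3) '' C ∪ (fun x : ℝ => (x + 2) / 3) '' C) :
    C = cantorSet := by
  have hC : ∀ x, x ∈ C ↔ ∃ y ∈ C, ∃ e ∈ ({0, 2} : Set ℝ), x = (y + e) / 3 := by
    intro x
    conv_lhs => rw [hself]
    simp only [Set.mem_union, Set.mem_image, Set.mem_insert_iff, Set.mem_singleton_iff,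
      exists_eq_or_imp, exists_eq_left, add_zero, and_or_left, exists_or, eq_comm]
  apply subset_antisymm
  · exact subset_of_forall_exists_add_div_three hc.isBounded (fun x hx => (hC x).1 hx)
      isClosed_cantorSet ⟨0, zero_mem_cantorSet⟩ fun y hy e he => add_div_three_mem_cantorSet hy he
  · exact subset_of_forall_exists_add_div_three isCompact_cantorSet.isBounded
      (fun x hx => mem_cantorSet_iff_exists.1 hx) hc.isClosed hne
      fun y hy e he => (hC _).2 ⟨y, hy, e, he, rfl⟩

lemma one_sub_mem_cantorSet {x : ℝ} (hx : x ∈ cantorSet) : 1 - x ∈ cantorSet := by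
  have hsub : (fun y : ℝ => 1 - y) '' cantorSet ⊆ cantorSet := by
    refine subset_of_forall_exists_add_div_three (E := {0, 2})
      (isCompact_cantorSet.image (by fun_prop)).isBounded ?_ isClosed_cantorSet
      ⟨0, zero_mem_cantorSet⟩ fun y hy e he => add_div_three_mem_cantorSet hy he
    rintro _ ⟨x, hx, rfl⟩
    obtain ⟨y, hy, e, he, rfl⟩ := mem_cantorSet_iff_exists.1 hx
    refine ⟨1 - y, ⟨y, hy, rfl⟩, 2 - e, ?_, by ring⟩
    rcases he with rfl | rfl <;> norm_num
  exact hsub ⟨x, hx, rfl⟩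

/-- The pairs of points of the Cantor set with difference `x`. -/
def cantorDiffPairs (x : ℝ) : Set (ℝ × ℝ) :=
  {p | p.1 ∈ cantorSet ∧ p.2 ∈ cantorSet ∧ -p.1 + p.2 = x}

/-- The number of representations of `x` as a difference of points of the Cantor set. -/
noncomputable def cantorDiffCount (x : ℝ) : ℕ∞ := (cantorDiffPairs x).encard

lemma cantorDiffCount_eq_zero {x : ℝ} (hx : 1 < |x|) : cantorDiffCount x = 0 := by
  rw [cantorDiffCount, Set.encard_eq_zero, Set.eq_empty_iff_forall_notMem]
  rintro p ⟨h₁, h₂, rfl⟩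
  have h₁ := cantorSet_subset_unitInterval h₁
  have h₂ := cantorSet_subset_unitInterval h₂
  exact hx.not_ge (abs_le.2 ⟨by linarith [h₁.2, h₂.1], by linarith [h₁.1, h₂.2]⟩)

lemma cantorDiffCount_eq (x : ℝ) : cantorDiffCount x =
    2 * cantorDiffCount (3 * x) + (cantorDiffCount (3 * x - 2) + cantorDiffCount (3 * x + 2)) := by
  let F : ℝ → ℝ → ℝ × ℝ → ℝ × ℝ := fun e₁ e₂ p => ((p.1 + e₁) / 3, (p.2 + e₂) / 3)
  have hF : ∀ e₁ e₂, Function.Injective (F e₁ e₂) := by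
    rintro e₁ e₂ ⟨a, b⟩ ⟨c, d⟩ h
    simp only [F, Prod.mk.injEq] at h ⊢
    constructor <;> linarith [h.1, h.2]
  have hunion : cantorDiffPairs x =
      (F 0 0 '' cantorDiffPairs (3 * x) ∪ F 2 2 '' cantorDiffPairs (3 * x)) ∪
      (F 0 2 '' cantorDiffPairs (3 * x - 2) ∪ F 2 0 '' cantorDiffPairs (3 * x + 2)) := by
    apply subset_antisymm
    · rintro ⟨b₁, b₂⟩ ⟨h₁, h₂, h⟩
      obtain ⟨c₁, hc₁, e₁, he₁, rfl⟩ := mem_cantorSet_iff_exists.1 h₁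
      obtain ⟨c₂, hc₂, e₂, he₂, rfl⟩ := mem_cantorSet_iff_exists.1 h₂
      simp only at h
      rcases he₁ with rfl | rfl <;> rcases he₂ with rfl | rfl
      · exact Or.inl (Or.inl ⟨(c₁, c₂), ⟨hc₁, hc₂, by simp only; linarith⟩, rfl⟩)
      · exact Or.inr (Or.inl ⟨(c₁, c₂), ⟨hc₁, hc₂, by simp only; linarith⟩, rfl⟩)
      · exact Or.inr (Or.inr ⟨(c₁, c₂), ⟨hc₁, hc₂, by simp only; linarith⟩, rfl⟩)
      · exact Or.inl (Or.inr ⟨(c₁, c₂), ⟨hc₁, hc₂, by simp only; linarith⟩, rfl⟩)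
    · have h0 : (0 : ℝ) ∈ ({0, 2} : Set ℝ) := by simp
      have h2 : (2 : ℝ) ∈ ({0, 2} : Set ℝ) := by simp
      rintro _ ((⟨p, ⟨h₁, h₂, h⟩, rfl⟩ | ⟨p, ⟨h₁, h₂, h⟩, rfl⟩) |
        (⟨p, ⟨h₁, h₂, h⟩, rfl⟩ | ⟨p, ⟨h₁, h₂, h⟩, rfl⟩))
      · exact ⟨add_div_three_mem_cantorSet h₁ h0, add_div_three_mem_cantorSet h₂ h0,
          by simp only [F]; linarith⟩
      · exact ⟨add_div_three_mem_cantorSet h₁ h2, add_div_three_mem_cantorSet h₂ h2,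
          by simp only [F]; linarith⟩
      · exact ⟨add_div_three_mem_cantorSet h₁ h0, add_div_three_mem_cantorSet h₂ h2,
          by simp only [F]; linarith⟩
      · exact ⟨add_div_three_mem_cantorSet h₁ h2, add_div_three_mem_cantorSet h₂ h0,
          by simp only [F]; linarith⟩
  have hmem : ∀ {e₁ e₂ y : ℝ} {q : ℝ × ℝ}, q ∈ F e₁ e₂ '' cantorDiffPairs y →
      (e₁ ≤ 3 * q.1 ∧ 3 * q.1 ≤ e₁ + 1) ∧ (e₂ ≤ 3 * q.2 ∧ 3 * q.2 ≤ e₂ + 1) := by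
    rintro e₁ e₂ y _ ⟨p, ⟨h₁, h₂, -⟩, rfl⟩
    have h₁ := cantorSet_subset_unitInterval h₁
    have h₂ := cantorSet_subset_unitInterval h₂
    simp only [F]
    refine ⟨⟨?_, ?_⟩, ?_, ?_⟩ <;> linarith [h₁.1, h₁.2, h₂.1, h₂.2]
  rw [cantorDiffCount, hunion, Set.encard_union_eq, Set.encard_union_eq, Set.encard_union_eq,
    (hF _ _).encard_image, (hF _ _).encard_image, (hF _ _).encard_image, (hF _ _).encard_image,
    two_mul]
  · rfl
  · refine Set.disjoint_left.2 fun q h h' => ?_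
    linarith [(hmem h).1.2, (hmem h').1.1]
  · refine Set.disjoint_left.2 fun q h h' => ?_
    linarith [(hmem h).1.2, (hmem h').1.1]
  · refine Set.disjoint_left.2 fun q h h' => ?_
    rcases h with h | h <;> rcases h' with h' | h' <;>
      linarith [(hmem h).1.1, (hmem h').1.1, (hmem h).1.2, (hmem h').1.2, (hmem h).2.1,
        (hmem h').2.1, (hmem h).2.2, (hmem h').2.2]

lemma cantorDiffCount_div_three {y : ℝ} (hy : |y| < 1) :
    cantorDiffCount (y / 3) = 2 * cantorDiffCount y := by
  obtain ⟨h₁, h₂⟩ := abs_lt.1 hy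
  rw [cantorDiffCount_eq, show 3 * (y / 3) = y by ring,
    cantorDiffCount_eq_zero (x := y - 2) (lt_abs.2 (Or.inr (by linarith))),
    cantorDiffCount_eq_zero (x := y + 2) (lt_abs.2 (Or.inl (by linarith))), add_zero, add_zero]

lemma cantorDiffCount_add_two_div_three {y : ℝ} (hy : |y| < 1) :
    cantorDiffCount ((y + 2) / 3) = cantorDiffCount y := by
  obtain ⟨h₁, h₂⟩ := abs_lt.1 hy
  rw [cantorDiffCount_eq, show 3 * ((y + 2) / 3) = y + 2 by ring, add_sub_cancel_right,
    cantorDiffCount_eq_zero (x := y + 2) (lt_abs.2 (Or.inl (by linarith))),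
    cantorDiffCount_eq_zero (x := y + 2 + 2) (lt_abs.2 (Or.inl (by linarith))), mul_zero, zero_add,
    add_zero]

lemma cantorDiffCount_sub_two_div_three {y : ℝ} (hy : |y| < 1) :
    cantorDiffCount ((y - 2) / 3) = cantorDiffCount y := by
  obtain ⟨h₁, h₂⟩ := abs_lt.1 hy
  rw [cantorDiffCount_eq, show 3 * ((y - 2) / 3) = y - 2 by ring, sub_add_cancel,
    cantorDiffCount_eq_zero (x := y - 2) (lt_abs.2 (Or.inr (by linarith))),
    cantorDiffCount_eq_zero (x := y - 2 - 2) (lt_abs.2 (Or.inr (by linarith))), mul_zero, zero_add,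
    zero_add]

/-- The point of the Cantor set with ternary digits `2 * a i`. -/
noncomputable def cantorPoint (a : ℕ → Fin 2) : ℝ :=
  2 * Real.ofDigits (fun i => (a i).castSucc : ℕ → Fin 3)

lemma ofDigits_eq_head_add_tail {b : ℕ} (a : ℕ → Fin b) :
    Real.ofDigits a = ((a 0 : ℕ) + Real.ofDigits fun i => a (i + 1)) / b := by
  rw [Real.ofDigits_eq_sum_add_ofDigits a 1]
  simp [Real.ofDigitsTerm]
  ring

lemma cantorPoint_eq (a : ℕ → Fin 2) :
    cantorPoint a = (cantorPoint (fun i => a (i + 1)) + 2 * (a 0 : ℕ)) / 3 := by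
  simp only [cantorPoint]
  rw [ofDigits_eq_head_add_tail]
  simp
  ring

lemma range_cantorPoint : Set.range cantorPoint = cantorSet := by
  have hclosed : IsClosed (Set.range cantorPoint) := by
    refine (isCompact_range ?_).isClosed
    unfold cantorPoint
    exact continuous_const.mul (Real.continuous_ofDigits.comp
      (continuous_pi fun i => (continuous_of_discreteTopology (f := Fin.castSucc)).comp
        (continuous_apply i)))
  have hbdd : Bornology.IsBounded (Set.range cantorPoint) := by
    refine (Metric.isBounded_Icc (0 : ℝ) 2).subset ?_
    rintro _ ⟨a, rfl⟩
    have h₁ := Real.ofDigits_nonneg (fun i => (a i).castSucc : ℕ → Fin 3)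
    have h₂ := Real.ofDigits_le_one (fun i => (a i).castSucc : ℕ → Fin 3)
    exact ⟨by unfold cantorPoint; linarith, by unfold cantorPoint; linarith⟩
  apply subset_antisymm
  · refine subset_of_forall_exists_add_div_three (E := {0, 2}) hbdd ?_ isClosed_cantorSet
      ⟨0, zero_mem_cantorSet⟩ fun y hy e he => add_div_three_mem_cantorSet hy he
    rintro _ ⟨a, rfl⟩
    refine ⟨_, ⟨_, rfl⟩, _, ?_, cantorPoint_eq a⟩
    rcases Fin.exists_fin_two.1 ⟨a 0, rfl⟩ with h | h <;> simp [h]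
  · refine subset_of_forall_exists_add_div_three (E := {0, 2}) isCompact_cantorSet.isBounded
      (fun x hx => mem_cantorSet_iff_exists.1 hx) hclosed (Set.range_nonempty _) ?_
    rintro _ ⟨a, rfl⟩ e he
    have key : ∀ d : Fin 2, (cantorPoint a + 2 * (d : ℕ)) / 3 ∈ Set.range cantorPoint := by
      intro d
      refine ⟨fun i => Nat.casesOn i d a, ?_⟩
      exact cantorPoint_eq _
    rcases he with rfl | rfl
    · simpa using key 0
    · simpa using key 1

lemma abs_ofDigits_sub_le_of_abs_cantorPoint_sub_lt (n : ℕ) : ∀ a a' : ℕ → Fin 2,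
    |cantorPoint a - cantorPoint a'| < (1 / 3) ^ n →
      |Real.ofDigits a - Real.ofDigits a'| ≤ (1 / 2) ^ n := by
  induction n with
  | zero =>
    intro a a' _
    rw [pow_zero]
    exact abs_sub_le_iff.2 ⟨by linarith [Real.ofDigits_nonneg a', Real.ofDigits_le_one a],
      by linarith [Real.ofDigits_nonneg a, Real.ofDigits_le_one a']⟩
  | succ n ih =>
    intro a a' h
    have hI : ∀ c, cantorPoint c ∈ Set.Icc (0 : ℝ) 1 := fun c =>
      cantorSet_subset_unitInterval (range_cantorPoint ▸ Set.mem_range_self c)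
    have h₁ := hI fun i => a (i + 1)
    have h₂ := hI fun i => a' (i + 1)
    rw [cantorPoint_eq a, cantorPoint_eq a'] at h
    have hpow : ((1 : ℝ) / 3) ^ n ≤ 1 := pow_le_one₀ (by norm_num) (by norm_num)
    have hhead : a 0 = a' 0 := by
      rw [pow_succ, abs_lt] at h
      rcases Fin.exists_fin_two.1 ⟨a 0, rfl⟩ with h0 | h0 <;>
        rcases Fin.exists_fin_two.1 ⟨a' 0, rfl⟩ with h0' | h0' <;>
        simp only [h0, h0', Fin.val_zero, Fin.val_one, Nat.cast_zero, Nat.cast_one] at h ⊢ <;>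
        exfalso <;> linarith [h.1, h.2, h₁.1, h₁.2, h₂.1, h₂.2]
    rw [hhead, show ∀ x y z : ℝ, (x + z) / 3 - (y + z) / 3 = (x - y) * (1 / 3) by intros; ring,
      abs_mul, abs_of_pos (by norm_num : (0 : ℝ) < 1 / 3), pow_succ,
      mul_lt_mul_iff_left₀ (by norm_num)] at h
    have := ih _ _ h
    rw [ofDigits_eq_head_add_tail a, ofDigits_eq_head_add_tail a', hhead, Nat.cast_ofNat,
      show ∀ x y z : ℝ, (z + x) / 2 - (z + y) / 2 = (x - y) * (1 / 2) by intros; ring,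
      abs_mul, abs_of_pos (by norm_num : (0 : ℝ) < 1 / 2), pow_succ]
    gcongr

lemma log_two_div_log_three_pos : 0 < Real.log 2 / Real.log 3 :=
  div_pos (Real.log_pos (by norm_num)) (Real.log_pos (by norm_num))

lemma three_rpow_log_two_div_log_three : (3 : ℝ) ^ (Real.log 2 / Real.log 3) = 2 := by
  rw [Real.log_div_log, Real.rpow_logb (by norm_num) (by norm_num) (by norm_num)]

lemma one_third_pow_rpow_log_two_div_log_three (n : ℕ) :
    (((1 : ℝ) / 3) ^ n) ^ (Real.log 2 / Real.log 3) = (1 / 2) ^ n := by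
  rw [← Real.rpow_natCast, ← Real.rpow_mul (by norm_num), mul_comm, Real.rpow_mul (by norm_num),
    Real.rpow_natCast, Real.div_rpow (by norm_num) (by norm_num), Real.one_rpow,
    three_rpow_log_two_div_log_three]

lemma abs_ofDigits_sub_le_rpow (a a' : ℕ → Fin 2) :
    |Real.ofDigits a - Real.ofDigits a'| ≤
      2 * |cantorPoint a - cantorPoint a'| ^ (Real.log 2 / Real.log 3) := by
  rcases (abs_nonneg (cantorPoint a - cantorPoint a')).eq_or_lt with h | h
  · rw [← h, Real.zero_rpow log_two_div_log_three_pos.ne', mul_zero]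
    have hlim : Filter.Tendsto (fun n : ℕ => ((1 : ℝ) / 2) ^ n) Filter.atTop (nhds 0) :=
      tendsto_pow_atTop_nhds_zero_of_lt_one (by norm_num) (by norm_num)
    exact ge_of_tendsto' hlim fun n =>
      abs_ofDigits_sub_le_of_abs_cantorPoint_sub_lt n a a' (h ▸ by positivity)
  · have hI : ∀ c, cantorPoint c ∈ Set.Icc (0 : ℝ) 1 := fun c =>
      cantorSet_subset_unitInterval (range_cantorPoint ▸ Set.mem_range_self c)
    have hle : |cantorPoint a - cantorPoint a'| ≤ 1 := abs_sub_le_iff.2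
      ⟨by linarith [(hI a).2, (hI a').1], by linarith [(hI a').2, (hI a).1]⟩
    obtain ⟨n, hn, hn'⟩ := exists_nat_pow_near_of_lt_one h hle
      (by norm_num : (0 : ℝ) < 1 / 3) (by norm_num)
    have hrpow := Real.rpow_le_rpow (by positivity) hn.le log_two_div_log_three_pos.le
    rw [one_third_pow_rpow_log_two_div_log_three, pow_succ] at hrpow
    rcases hn'.lt_or_eq with hn' | hn'
    · linarith [abs_ofDigits_sub_le_of_abs_cantorPoint_sub_lt n a a' hn']
    · rcases n with _ | n
      · rw [hn', pow_zero, Real.one_rpow]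
        have := abs_sub_le_iff.2
          ⟨(by linarith [Real.ofDigits_nonneg a', Real.ofDigits_le_one a] :
            Real.ofDigits a - Real.ofDigits a' ≤ 1),
          by linarith [Real.ofDigits_nonneg a, Real.ofDigits_le_one a']⟩
        linarith
      · have := abs_ofDigits_sub_le_of_abs_cantorPoint_sub_lt n a a' (hn' ▸
          pow_lt_pow_right_of_lt_one₀ (by norm_num) (by norm_num) (Nat.lt_succ_self n))
        rw [hn', one_third_pow_rpow_log_two_div_log_three, pow_succ]
        linarith

lemma hausdorffMeasure_cantorSet_pos : 0 < μH[Real.log 2 / Real.log 3] cantorSet := by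
  let f : ℝ → ℝ := fun x => Real.ofDigits (Function.invFun cantorPoint x)
  have hinv : ∀ x ∈ cantorSet, cantorPoint (Function.invFun cantorPoint x) = x := fun x hx =>
    Function.invFun_eq (by rwa [← range_cantorPoint] at hx)
  have hf : HolderOnWith 2 (Real.log 2 / Real.log 3).toNNReal f cantorSet := by
    intro x hx y hy
    have h := abs_ofDigits_sub_le_rpow (Function.invFun cantorPoint x)
      (Function.invFun cantorPoint y)
    rw [hinv x hx, hinv y hy] at h
    rw [edist_dist, edist_dist, Real.dist_eq, Real.dist_eq,
      Real.coe_toNNReal _ log_two_div_log_three_pos.le,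
      ENNReal.ofReal_rpow_of_nonneg (abs_nonneg _) log_two_div_log_three_pos.le,
      show ((2 : NNReal) : ENNReal) = ENNReal.ofReal 2 by simp,
      ← ENNReal.ofReal_mul (by norm_num)]
    exact ENNReal.ofReal_le_ofReal h
  have hsub : Set.Icc (0 : ℝ) 1 ⊆ f '' cantorSet := by
    intro t ht
    obtain ⟨a, -, rfl⟩ := Real.ofDigits_SurjOn (b := 2) (by norm_num) ht
    have ha : cantorPoint a ∈ cantorSet := range_cantorPoint ▸ Set.mem_range_self a
    refine ⟨cantorPoint a, ha, ?_⟩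
    have h := abs_ofDigits_sub_le_rpow (Function.invFun cantorPoint (cantorPoint a)) a
    rw [hinv _ ha, sub_self, abs_zero, Real.zero_rpow log_two_div_log_three_pos.ne',
      mul_zero] at h
    exact sub_eq_zero.1 (abs_nonpos_iff.1 h)
  have hle := hf.hausdorffMeasure_image_le
    (Real.toNNReal_pos.2 log_two_div_log_three_pos) zero_le_one
  rw [mul_one, Real.coe_toNNReal _ log_two_div_log_three_pos.le] at hle
  rw [pos_iff_ne_zero]
  intro h0
  rw [h0, mul_zero, hausdorffMeasure_real] at hle
  simpa using (measure_mono hsub).trans hle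

lemma hausdorffMeasure_cantorSet_ne_top : μH[Real.log 2 / Real.log 3] cantorSet ≠ ⊤ := by
  let t : ∀ n : ℕ, (Fin n → Fin 2) → Set ℝ := fun n w => cantorPoint '' {a | ∀ i : Fin n, a i = w i}
  let r : ℕ → ENNReal := fun n => ENNReal.ofReal (2 * (1 / 3) ^ n)
  have hr : Filter.Tendsto r Filter.atTop (nhds 0) := by
    rw [← ENNReal.ofReal_zero]
    refine ENNReal.tendsto_ofReal ?_
    simpa using (tendsto_pow_atTop_nhds_zero_of_lt_one (by norm_num : (0 : ℝ) ≤ 1 / 3)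
      (by norm_num)).const_mul 2
  have ht : ∀ n w, Metric.ediam (t n w) ≤ r n := by
    intro n w
    refine Metric.ediam_le ?_
    rintro _ ⟨a, ha, rfl⟩ _ ⟨a', ha', rfl⟩
    rw [edist_dist, Real.dist_eq]
    refine ENNReal.ofReal_le_ofReal ?_
    rw [cantorPoint, cantorPoint, ← mul_sub, abs_mul, abs_two]
    have := Real.abs_ofDigits_sub_ofDigits_le (n := n)
      (x := fun i => (a i).castSucc) (y := fun i => (a' i).castSucc)
      fun i hi => by rw [ha ⟨i, hi⟩, ha' ⟨i, hi⟩]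
    simpa using this
  have hst : ∀ n, cantorSet ⊆ ⋃ w, t n w := by
    intro n x hx
    rw [← range_cantorPoint] at hx
    obtain ⟨a, rfl⟩ := hx
    exact Set.mem_iUnion.2 ⟨fun i => a i, a, fun i => rfl, rfl⟩
  have hle := Measure.hausdorffMeasure_le_liminf_sum (Real.log 2 / Real.log 3) cantorSet r hr t
    (Filter.Eventually.of_forall ht) (Filter.Eventually.of_forall hst)
  have hsum : ∀ n, ∑ w, Metric.ediam (t n w) ^ (Real.log 2 / Real.log 3) ≤
      ENNReal.ofReal (2 ^ (Real.log 2 / Real.log 3)) := by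
    intro n
    calc ∑ w, Metric.ediam (t n w) ^ (Real.log 2 / Real.log 3)
        ≤ ∑ _w : Fin n → Fin 2, r n ^ (Real.log 2 / Real.log 3) := by
          gcongr with w
          exact ht n w
      _ = ENNReal.ofReal (2 ^ (Real.log 2 / Real.log 3)) := by
          simp only [Finset.sum_const, Finset.card_univ, Fintype.card_fun, Fintype.card_fin,
            nsmul_eq_mul, r]
          rw [ENNReal.ofReal_rpow_of_nonneg (by positivity) log_two_div_log_three_pos.le,
            ← ENNReal.ofReal_natCast, ← ENNReal.ofReal_mul (by positivity),
            Real.mul_rpow (by norm_num) (by positivity),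
            one_third_pow_rpow_log_two_div_log_three, mul_left_comm]
          congr 1
          push_cast
          rw [← mul_pow]
          norm_num
  refine ne_top_of_le_ne_top
    (ENNReal.ofReal_ne_top (r := 2 ^ (Real.log 2 / Real.log 3))) (hle.trans ?_)
  exact (Filter.liminf_le_liminf (Filter.Eventually.of_forall hsum)).trans_eq
    (Filter.liminf_const _)

lemma dimH_cantorSet_le : dimH cantorSet ≤ ENNReal.ofReal (Real.log 2 / Real.log 3) := by
  refine dimH_le_of_hausdorffMeasure_ne_top (d := (Real.log 2 / Real.log 3).toNNReal) ?_
  rw [Real.coe_toNNReal _ log_two_div_log_three_pos.le]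
  exact hausdorffMeasure_cantorSet_ne_top

/-- The Cantor set rescaled to `[-1, 1]`. -/
def centeredCantorSet : Set ℝ := (fun c => 2 * c - 1) '' cantorSet

lemma isCompact_centeredCantorSet : IsCompact centeredCantorSet :=
  isCompact_cantorSet.image (by fun_prop)

lemma centeredCantorSet_subset_Icc : centeredCantorSet ⊆ Set.Icc (-1) 1 := by
  rintro _ ⟨c, hc, rfl⟩
  have hc := cantorSet_subset_unitInterval hc
  exact ⟨by linarith [hc.1], by linarith [hc.2]⟩

lemma mem_centeredCantorSet_iff_exists {x : ℝ} : x ∈ centeredCantorSet ↔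
    ∃ y ∈ centeredCantorSet, ∃ e ∈ ({-2, 2} : Set ℝ), x = (y + e) / 3 := by
  constructor
  · rintro ⟨c, hc, rfl⟩
    obtain ⟨d, hd, e, he, rfl⟩ := mem_cantorSet_iff_exists.1 hc
    refine ⟨2 * d - 1, ⟨d, hd, rfl⟩, 2 * e - 2, ?_, by ring⟩
    rcases he with rfl | rfl <;> norm_num
  · rintro ⟨_, ⟨d, hd, rfl⟩, e, he, rfl⟩
    refine ⟨(d + (e + 2) / 2) / 3, add_div_three_mem_cantorSet hd ?_, by ring⟩
    rcases he with rfl | rfl <;> norm_num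

lemma dimH_centeredCantorSet_le :
    dimH centeredCantorSet ≤ ENNReal.ofReal (Real.log 2 / Real.log 3) := by
  refine (LipschitzWith.dimH_image_le (K := 2) ?_ _).trans dimH_cantorSet_le
  refine LipschitzWith.of_dist_le_mul fun x y => ?_
  rw [Real.dist_eq, Real.dist_eq, show 2 * x - 1 - (2 * y - 1) = 2 * (x - y) by ring, abs_mul]
  simp

lemma hausdorffMeasure_centeredCantorSet_pos :
    0 < μH[Real.log 2 / Real.log 3] centeredCantorSet := by
  have h : AntilipschitzWith 1 fun c : ℝ => 2 * c - 1 := by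
    refine AntilipschitzWith.of_le_mul_dist fun x y => ?_
    rw [Real.dist_eq, Real.dist_eq, show 2 * x - 1 - (2 * y - 1) = 2 * (x - y) by ring, abs_mul,
      abs_two, NNReal.coe_one]
    linarith [abs_nonneg (x - y)]
  have hle := h.le_hausdorffMeasure_image log_two_div_log_three_pos.le cantorSet
  rw [ENNReal.coe_one, ENNReal.one_rpow, one_mul] at hle
  exact hausdorffMeasure_cantorSet_pos.trans_le hle

/-- The numbers with a signed ternary expansion with digits `-2, 0, 2`, in which the digits after
the `n`-th one are nonzero. -/
def eventuallyNonzeroDigits : ℕ → Set ℝ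
  | 0 => centeredCantorSet
  | n + 1 => ⋃ e ∈ ({-2, 0, 2} : Set ℝ), (fun y => (y + e) / 3) '' eventuallyNonzeroDigits n

lemma dimH_eventuallyNonzeroDigits_le (n : ℕ) :
    dimH (eventuallyNonzeroDigits n) ≤ ENNReal.ofReal (Real.log 2 / Real.log 3) := by
  induction n with
  | zero => exact dimH_centeredCantorSet_le
  | succ n ih =>
    rw [eventuallyNonzeroDigits, dimH_bUnion (Set.toFinite _).countable]
    refine iSup₂_le fun e _ => (LipschitzWith.dimH_image_le (K := 1) ?_ _).trans ih
    refine LipschitzWith.of_dist_le_mul fun x y => ?_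
    rw [Real.dist_eq, Real.dist_eq, show (x + e) / 3 - (y + e) / 3 = (x - y) / 3 by ring, abs_div,
      NNReal.coe_one, abs_of_pos (by norm_num : (0 : ℝ) < 3)]
    linarith [abs_nonneg (x - y)]

lemma add_div_three_mem_iUnion_eventuallyNonzeroDigits {y : ℝ}
    (hy : y ∈ ⋃ n, eventuallyNonzeroDigits n) {e : ℝ} (he : e ∈ ({-2, 0, 2} : Set ℝ)) :
    (y + e) / 3 ∈ ⋃ n, eventuallyNonzeroDigits n := by
  obtain ⟨n, hn⟩ := Set.mem_iUnion.1 hy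
  exact Set.mem_iUnion.2 ⟨n + 1, Set.mem_biUnion he ⟨y, hn, rfl⟩⟩

lemma one_le_cantorDiffCount {x : ℝ} (hx : x ∈ Set.Icc (-1 : ℝ) 1) : 1 ≤ cantorDiffCount x := by
  have hsub : Set.Icc (-1 : ℝ) 1 ⊆ (fun p : ℝ × ℝ => -p.1 + p.2) '' (cantorSet ×ˢ cantorSet) := by
    refine subset_of_forall_exists_add_div_three (E := {-2, 0, 2}) (Metric.isBounded_Icc _ _) ?_
      ((isCompact_cantorSet.prod isCompact_cantorSet).image (by fun_prop)).isClosed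
      ⟨_, (0, 0), ⟨zero_mem_cantorSet, zero_mem_cantorSet⟩, rfl⟩ ?_
    · intro x hx
      rcases lt_or_ge 1 (3 * x) with h | h
      · exact ⟨3 * x - 2, ⟨by linarith, by linarith [hx.2]⟩, 2, by simp, by ring⟩
      rcases lt_or_ge (3 * x) (-1) with h' | h'
      · exact ⟨3 * x + 2, ⟨by linarith [hx.1], by linarith⟩, -2, by simp, by ring⟩
      · exact ⟨3 * x, ⟨h', h⟩, 0, by simp, by ring⟩
    · rintro _ ⟨p, ⟨h₁, h₂⟩, rfl⟩ e he
      have key : ∀ e₁ ∈ ({0, 2} : Set ℝ), ∀ e₂ ∈ ({0, 2} : Set ℝ), e = e₂ - e₁ →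
          (-p.1 + p.2 + e) / 3 ∈
            (fun p : ℝ × ℝ => -p.1 + p.2) '' (cantorSet ×ˢ cantorSet) := by
        rintro e₁ he₁ e₂ he₂ rfl
        exact ⟨((p.1 + e₁) / 3, (p.2 + e₂) / 3), ⟨add_div_three_mem_cantorSet h₁ he₁,
          add_div_three_mem_cantorSet h₂ he₂⟩, by ring⟩
      rcases he with rfl | rfl | rfl
      · exact key 2 (by simp) 0 (by simp) (by norm_num)
      · exact key 0 (by simp) 0 (by simp) (by norm_num)
      · exact key 0 (by simp) 2 (by simp) (by norm_num)
  obtain ⟨p, ⟨h₁, h₂⟩, h⟩ := hsub hx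
  exact Set.one_le_encard_iff_nonempty.2 ⟨p, h₁, h₂, h⟩

lemma two_pow_le_cantorDiffCount (k : ℕ) : ∀ x ∈ Set.Icc (-1 : ℝ) 1,
    x ∉ ⋃ n, eventuallyNonzeroDigits n → 2 ^ k ≤ cantorDiffCount x := by
  induction k with
  | zero =>
    intro x hx _
    rw [pow_zero]
    exact one_le_cantorDiffCount hx
  | succ k ih =>
    by_contra! hcon
    obtain ⟨x₀, hx₀, hx₀W, hlt⟩ := hcon
    let A : Set ℝ := {x ∈ Set.Icc (-1 : ℝ) 1 |
      x ∉ ⋃ n, eventuallyNonzeroDigits n ∧ cantorDiffCount x < 2 ^ (k + 1)}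
    have hA : A ⊆ centeredCantorSet := by
      refine subset_of_forall_exists_add_div_three (E := {-2, 2})
        ((Metric.isBounded_Icc (-1 : ℝ) 1).subset fun x hx => hx.1) ?_
        isCompact_centeredCantorSet.isClosed
        ⟨_, 0, zero_mem_cantorSet, rfl⟩
        fun y hy e he => mem_centeredCantorSet_iff_exists.2 ⟨y, hy, e, he, rfl⟩
      rintro x ⟨hx, hxW, hxlt⟩
      rw [cantorDiffCount_eq x] at hxlt
      have hW : ∀ e ∈ ({-2, 0, 2} : Set ℝ), 3 * x - e ∉ ⋃ n, eventuallyNonzeroDigits n := by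
        intro e he h
        refine hxW ?_
        have := add_div_three_mem_iUnion_eventuallyNonzeroDigits h he
        rwa [sub_add_cancel, mul_div_cancel_left₀ _ (by norm_num)] at this
      rcases lt_or_ge 1 (3 * x) with h | h
      · refine ⟨3 * x - 2, ⟨⟨by linarith, by linarith [hx.2]⟩, hW 2 (by simp), ?_⟩, 2, by simp,
          by ring⟩
        refine lt_of_le_of_lt ?_ hxlt
        exact le_self_add.trans le_add_self
      rcases lt_or_ge (3 * x) (-1) with h' | h'
      · refine ⟨3 * x + 2, ⟨⟨by linarith [hx.1], by linarith⟩, ?_, ?_⟩, -2, by simp, by ring⟩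
        · simpa using hW (-2) (by simp)
        refine lt_of_le_of_lt ?_ hxlt
        exact le_add_self.trans le_add_self
      · have h3 := ih (3 * x) ⟨h', h⟩ (by simpa using hW 0 (by simp))
        refine absurd hxlt (not_lt.2 ?_)
        rw [pow_succ']
        exact (mul_le_mul_right h3 2).trans le_self_add
    exact hx₀W (Set.mem_iUnion.2 ⟨0, hA ⟨hx₀, hx₀W, hlt⟩⟩)

/-- The points of `(-1, 1)` with exactly `2 ^ u` representations as differences of points of the
Cantor set. -/
def cantorDiffCountLevel (u : ℕ) : Set ℝ := {x ∈ Set.Ioo (-1 : ℝ) 1 | cantorDiffCount x = 2 ^ u}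

/-- The numbers `k / 3 ^ n`. -/
def triadicRationals : Set ℝ := {x | ∃ (n : ℕ) (k : ℤ), x * 3 ^ n = k}

lemma countable_triadicRationals : triadicRationals.Countable := by
  refine (Set.countable_range fun p : ℕ × ℤ => (p.2 : ℝ) / 3 ^ p.1).mono ?_
  rintro x ⟨n, k, h⟩
  exact ⟨(n, k), by simp only; rw [← h]; field_simp⟩

lemma mem_Ioo_of_notMem_triadicRationals {x : ℝ} (hx : x ∈ centeredCantorSet)
    (hxQ : x ∉ triadicRationals) : x ∈ Set.Ioo (-1 : ℝ) 1 := by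
  have h := centeredCantorSet_subset_Icc hx
  refine ⟨h.1.lt_of_ne ?_, h.2.lt_of_ne ?_⟩
  · rintro rfl
    exact hxQ ⟨0, -1, by simp⟩
  · rintro rfl
    exact hxQ ⟨0, 1, by simp⟩

lemma exists_forall_mem_cantorDiffPairs_fst_eq {y : ℝ} (hy : y ∈ Set.Ioo (-1 : ℝ) 1) {e : ℝ}
    (he : e ∈ ({-2, 2} : Set ℝ)) : ∃ e₁, ∀ p ∈ cantorDiffPairs ((y + e) / 3),
      ∃ q ∈ cantorDiffPairs y, p.1 = (q.1 + e₁) / 3 := by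
  refine ⟨(2 - e) / 2, ?_⟩
  rintro ⟨b₁, b₂⟩ ⟨h₁, h₂, h⟩
  obtain ⟨c₁, hc₁, e₁, he₁, rfl⟩ := mem_cantorSet_iff_exists.1 h₁
  obtain ⟨c₂, hc₂, e₂, he₂, rfl⟩ := mem_cantorSet_iff_exists.1 h₂
  have hI₁ := cantorSet_subset_unitInterval hc₁
  have hI₂ := cantorSet_subset_unitInterval hc₂
  simp only at h
  refine ⟨(c₁, c₂), ⟨hc₁, hc₂, ?_⟩, ?_⟩ <;>
  rcases he with rfl | rfl <;> rcases he₁ with rfl | rfl <;> rcases he₂ with rfl | rfl <;>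
    simp only <;> linarith [hI₁.1, hI₁.2, hI₂.1, hI₂.2, hy.1, hy.2]

lemma abs_fst_sub_fst_le (n : ℕ) : ∀ x ∈ centeredCantorSet, x ∉ triadicRationals →
    ∀ p ∈ cantorDiffPairs x, ∀ q ∈ cantorDiffPairs x, |p.1 - q.1| ≤ (1 / 3) ^ n := by
  induction n with
  | zero =>
    intro x _ _ p hp q hq
    have h₁ := cantorSet_subset_unitInterval hp.1
    have h₂ := cantorSet_subset_unitInterval hq.1
    rw [pow_zero]
    exact abs_sub_le_iff.2 ⟨by linarith [h₁.2, h₂.1], by linarith [h₁.1, h₂.2]⟩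
  | succ n ih =>
    intro x hx hxQ p hp q hq
    obtain ⟨y, hy, e, he, rfl⟩ := mem_centeredCantorSet_iff_exists.1 hx
    have hyQ : y ∉ triadicRationals := by
      rintro ⟨m, k, h⟩
      rcases he with rfl | rfl
      · exact hxQ ⟨m + 1, k - 2 * 3 ^ m, by push_cast; rw [← h]; ring⟩
      · exact hxQ ⟨m + 1, k + 2 * 3 ^ m, by push_cast; rw [← h]; ring⟩
    obtain ⟨e₁, he₁⟩ :=
      exists_forall_mem_cantorDiffPairs_fst_eq (mem_Ioo_of_notMem_triadicRationals hy hyQ) he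
    obtain ⟨p', hp', hp⟩ := he₁ p hp
    obtain ⟨q', hq', hq⟩ := he₁ q hq
    have := ih y hy hyQ p' hp' q' hq'
    rw [hp, hq, show (p'.1 + e₁) / 3 - (q'.1 + e₁) / 3 = (p'.1 - q'.1) * (1 / 3) by ring, abs_mul,
      abs_of_pos (by norm_num : (0 : ℝ) < 1 / 3), pow_succ]
    gcongr

lemma centeredCantorSet_diff_subset_cantorDiffCountLevel_zero :
    centeredCantorSet \ triadicRationals ⊆ cantorDiffCountLevel 0 := by
  rintro x ⟨hx, hxQ⟩
  refine ⟨mem_Ioo_of_notMem_triadicRationals hx hxQ, ?_⟩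
  rw [pow_zero, cantorDiffCount, Set.encard_eq_one]
  obtain ⟨c, hc, hcx⟩ := id hx
  refine ⟨(1 - c, c), Set.eq_singleton_iff_unique_mem.2
    ⟨⟨one_sub_mem_cantorSet hc, hc, by simp only at hcx ⊢; linarith⟩, fun p hp => ?_⟩⟩
  have hmem : ((1 - c, c) : ℝ × ℝ) ∈ cantorDiffPairs x :=
    ⟨one_sub_mem_cantorSet hc, hc, by simp only at hcx ⊢; linarith⟩
  have hlim : Filter.Tendsto (fun n : ℕ => ((1 : ℝ) / 3) ^ n) Filter.atTop (nhds 0) :=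
    tendsto_pow_atTop_nhds_zero_of_lt_one (by norm_num) (by norm_num)
  have h0 := ge_of_tendsto' hlim fun n => abs_fst_sub_fst_le n x hx hxQ p hp _ hmem
  have h1 : p.1 = 1 - c := sub_eq_zero.1 (abs_nonpos_iff.1 h0)
  have h2 := hp.2.2
  refine Prod.ext h1 ?_
  simp only at hcx ⊢
  linarith

lemma hausdorffMeasure_image_add_div_three (e : ℝ) (s : Set ℝ) :
    μH[Real.log 2 / Real.log 3] ((fun y => (y + e) / 3) '' s) =
      2⁻¹ * μH[Real.log 2 / Real.log 3] s := by
  have himage : (fun y : ℝ => (y + e) / 3) '' s =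
      IsometryEquiv.addRight (e / 3) '' ((fun y => (3 : ℝ)⁻¹ • y) '' s) := by
    rw [Set.image_image]
    refine Set.image_congr fun y _ => ?_
    simp only [smul_eq_mul, IsometryEquiv.addRight_apply]
    ring
  have hnorm : (‖(3 : ℝ)⁻¹‖₊ ^ (Real.log 2 / Real.log 3) : NNReal) = 2⁻¹ := by
    rw [← NNReal.coe_inj, NNReal.coe_rpow, coe_nnnorm, norm_inv, Real.norm_ofNat,
      Real.inv_rpow (by norm_num), three_rpow_log_two_div_log_three]
    simp
  rw [himage, IsometryEquiv.hausdorffMeasure_image, Set.image_smul,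
    Measure.hausdorffMeasure_smul₀ log_two_div_log_three_pos.le (by norm_num), hnorm,
    ENNReal.smul_def, smul_eq_mul]
  simp

lemma hausdorffMeasure_cantorDiffCountLevel_pos (u : ℕ) :
    0 < μH[Real.log 2 / Real.log 3] (cantorDiffCountLevel u) := by
  induction u with
  | zero =>
    have := Measure.nullSingletonClass_hausdorff ℝ log_two_div_log_three_pos
    refine lt_of_lt_of_le ?_ (measure_mono centeredCantorSet_diff_subset_cantorDiffCountLevel_zero)
    rw [measure_sdiff_null (countable_triadicRationals.measure_zero _)]
    exact hausdorffMeasure_centeredCantorSet_pos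
  | succ u ih =>
    have hsub : (fun y => (y + 0) / 3) '' cantorDiffCountLevel u ⊆ cantorDiffCountLevel (u + 1) := by
      rintro _ ⟨y, ⟨hy, hyu⟩, rfl⟩
      refine ⟨⟨by linarith [hy.1], by linarith [hy.2]⟩, ?_⟩
      simp only [add_zero]
      rw [cantorDiffCount_div_three (abs_lt.2 hy), hyu, pow_succ']
    refine lt_of_lt_of_le ?_ (measure_mono hsub)
    rw [hausdorffMeasure_image_add_div_three]
    exact ENNReal.mul_pos (by simp) ih.ne'

lemma hausdorffMeasure_cantorDiffCountLevel_succ (u : ℕ) :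
    μH[Real.log 2 / Real.log 3] (cantorDiffCountLevel (u + 1)) = ⊤ := by
  have hsub : (fun y => (y + 0) / 3) '' cantorDiffCountLevel u ∪
      ((fun y => (y + 2) / 3) '' cantorDiffCountLevel (u + 1) ∪
        (fun y => (y + -2) / 3) '' cantorDiffCountLevel (u + 1)) ⊆
      cantorDiffCountLevel (u + 1) := by
    rintro _ (⟨y, ⟨hy, hyu⟩, rfl⟩ | ⟨y, ⟨hy, hyu⟩, rfl⟩ | ⟨y, ⟨hy, hyu⟩, rfl⟩)
    · refine ⟨⟨by linarith [hy.1], by linarith [hy.2]⟩, ?_⟩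
      simp only [add_zero]
      rw [cantorDiffCount_div_three (abs_lt.2 hy), hyu, pow_succ']
    · refine ⟨⟨by linarith [hy.1], by linarith [hy.2]⟩, ?_⟩
      rw [cantorDiffCount_add_two_div_three (abs_lt.2 hy), hyu]
    · refine ⟨⟨by linarith [hy.1], by linarith [hy.2]⟩, ?_⟩
      simp only [← sub_eq_add_neg]
      rw [cantorDiffCount_sub_two_div_three (abs_lt.2 hy), hyu]
  have himage : ∀ (e : ℝ) (v : ℕ), (fun y => (y + e) / 3) '' cantorDiffCountLevel v ⊆
      Set.Ioo ((e - 1) / 3) ((e + 1) / 3) := by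
    rintro e v _ ⟨y, ⟨hy, -⟩, rfl⟩
    exact ⟨by linarith [hy.1], by linarith [hy.2]⟩
  have hunion : ∀ {s t : Set ℝ} {a b : ℝ}, s ⊆ Set.Ioo a b → Disjoint t (Set.Ioo a b) →
      μH[Real.log 2 / Real.log 3] s + μH[Real.log 2 / Real.log 3] t ≤
        μH[Real.log 2 / Real.log 3] (s ∪ t) := by
    intro s t a b hs ht
    rw [← measure_inter_add_sdiff (s ∪ t) (measurableSet_Ioo (a := a) (b := b))]
    gcongr
    · exact fun x hx => ⟨Or.inl hx, hs hx⟩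
    · exact fun x hx => ⟨Or.inr hx, Set.disjoint_left.1 ht hx⟩
  have hle := ((add_le_add_right (hunion (himage 2 (u + 1)) ?_) _).trans
    (hunion (himage 0 u) ?_)).trans (measure_mono hsub)
  · simp only [hausdorffMeasure_image_add_div_three] at hle
    rw [← add_mul, ENNReal.inv_two_add_inv_two, one_mul, add_comm] at hle
    by_contra htop
    refine hle.not_gt (ENNReal.lt_add_right htop ?_)
    exact mul_ne_zero (by simp) (hausdorffMeasure_cantorDiffCountLevel_pos u).ne'
  · refine Set.disjoint_left.2 fun x hx hx' => ?_
    linarith [(himage _ _ hx).2, hx'.1]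
  · refine Set.disjoint_left.2 fun x hx hx' => ?_
    rcases hx with hx | hx <;>
      linarith [hx'.1, hx'.2, (himage _ _ hx).1, (himage _ _ hx).2]

/-- For the middle-third Cantor set `C` and `S_x = {(b₁,b₂) ∈ C × C : -b₁ + b₂ = x}`, for each
`u ∈ ℕ⁺` the set of `x ∈ [-1,1]` with exactly `2^u` representations has Hausdorff dimension
`log 2 / log 3` and infinite `(log 2 / log 3)`-dimensional Hausdorff measure. -/
theorem cantor_diff_power_of_two_representations (C : Set ℝ) (hne : C.Nonempty)
    (hc : IsCompact C)
    (hself : C = (fun x : ℝ => x / 3) '' C ∪ (fun x : ℝ => (x + 2) / 3) '' C)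
    (u : ℕ) (hu : 1 ≤ u) (U : Set ℝ)
    (hU : U = {x ∈ Set.Icc (-1 : ℝ) 1 |
      {p : ℝ × ℝ | p.1 ∈ C ∧ p.2 ∈ C ∧ -p.1 + p.2 = x}.encard = 2 ^ u}) :
    dimH U = ENNReal.ofReal (Real.log 2 / Real.log 3) ∧
    μH[Real.log 2 / Real.log 3] U = ⊤ := by
  obtain rfl := eq_cantorSet_of_isCompact hne hc hself
  replace hU : U = {x ∈ Set.Icc (-1 : ℝ) 1 | cantorDiffCount x = 2 ^ u} := hU
  obtain ⟨u, rfl⟩ := Nat.exists_eq_add_of_le' hu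
  have htop : μH[Real.log 2 / Real.log 3] U = ⊤ := by
    refine top_le_iff.1 ((hausdorffMeasure_cantorDiffCountLevel_succ u).symm.trans_le
      (measure_mono ?_))
    rw [hU]
    exact fun x hx => ⟨Set.Ioo_subset_Icc_self hx.1, hx.2⟩
  refine ⟨le_antisymm ?_ ?_, htop⟩
  · have hsub : U ⊆ ⋃ n, eventuallyNonzeroDigits n := by
      intro x hx
      rw [hU] at hx
      by_contra hxW
      have h := two_pow_le_cantorDiffCount (u + 2) x hx.1 hxW
      rw [hx.2] at h
      have h' : 2 ^ (u + 2) ≤ 2 ^ (u + 1) := by exact_mod_cast h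
      have := (Nat.pow_le_pow_iff_right (by norm_num)).1 h'
      omega
    refine (dimH_mono hsub).trans ?_
    rw [dimH_iUnion]
    exact iSup_le dimH_eventuallyNonzeroDigits_le
  · refine le_dimH_of_hausdorffMeasure_eq_top (d := (Real.log 2 / Real.log 3).toNNReal) ?_
    rwa [Real.coe_toNNReal _ log_two_div_log_three_pos.le]
end
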